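/- arXiv:1501.03643 — 3 statements merged into one kernel-verified Lean document; each statement's English description precedes it below -/
import Mathlib

section
/- Let (H, A, ‖·‖♯) be a compressed sensing space with bound L > 0, let Φ : H → ℝ^M be linear, let κ ∈ (0,1), and suppose ρ > 0 satisfies ρ < (1−κ)/(2L) and Φ satisfies the (ρ,α)-robust width property over the unit ♯-ball for some α > 0. Set C₀ = ((1−κ)/(2ρ) − L)⁻¹ and C₁ = (1+κ)/(α²ρ). Then for every x♮ ∈ H, every λ > 0, and every ω ∈ ℝ^M with ‖Φᵀω‖♦ ≤ κλ, any minimizer x* of the function x ↦ (1/2)‖Φx − (Φx♮ + ω)‖₂² + λ‖x‖♯ satisfies ‖x* − x♮‖₂ ≤ C₀‖x♮ − a‖♯ + C₁·λ for every a ∈ A. -/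
noncomputable section

open scoped RealInnerProductSpace

variable {H : Type*} [NormedAddCommGroup H] [InnerProductSpace ℝ H] [FiniteDimensional ℝ H]

/-- `sharp` is a norm on `H`. -/
structure IsNormOn (sharp : H → ℝ) : Prop where
  triangle : ∀ x y : H, sharp (x + y) ≤ sharp x + sharp y
  smul_eq : ∀ (c : ℝ) (x : H), sharp (c • x) = |c| * sharp x
  eq_zero_of : ∀ x : H, sharp x = 0 → x = 0

/-- The dual norm of `sharp`: `‖u‖♦ = sup {|⟨u,v⟩| : ‖v‖♯ ≤ 1}`. -/
def dualNorm (sharp : H → ℝ) (u : H) : ℝ :=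
  sSup {r : ℝ | ∃ v : H, sharp v ≤ 1 ∧ r = |⟪u, v⟫|}

/-- The subdifferential of `f` at `x`. -/
def subdiff (f : H → ℝ) (x : H) : Set H :=
  {u : H | ∀ y : H, f y ≥ f x + ⟪u, y - x⟫}

/-- `(H, A, sharp)` is a compressed sensing space with bound `L`. -/
structure IsCSSpace (A : Set H) (sharp : H → ℝ) (L : ℝ) : Prop where
  zero_mem : (0 : H) ∈ A
  decomp : ∀ a ∈ A, ∀ v : H, ∃ z₁ z₂ : H, v = z₁ + z₂ ∧
    sharp (a + z₁) = sharp a + sharp z₁ ∧ sharp z₂ ≤ L * ‖v‖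

/-- `Φ` satisfies the `(ρ, α)`-robust width property over the unit `sharp`-ball. -/
def RobustWidth {M : ℕ} (Φ : H →ₗ[ℝ] EuclideanSpace ℝ (Fin M)) (sharp : H → ℝ)
    (ρ α : ℝ) : Prop :=
  ∀ x : H, ‖Φ x‖ < α * ‖x‖ → ‖x‖ ≤ ρ * sharp x

section

variable {E : Type*} [NormedAddCommGroup E] [InnerProductSpace ℝ E]

namespace IsNormOn

variable {sharp : E → ℝ}

lemma map_zero (hs : IsNormOn sharp) : sharp 0 = 0 := by
  simpa using hs.smul_eq 0 0

lemma map_neg (hs : IsNormOn sharp) (x : E) : sharp (-x) = sharp x := by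
  simpa using hs.smul_eq (-1) x

lemma nonneg (hs : IsNormOn sharp) (x : E) : 0 ≤ sharp x := by
  have h := hs.triangle x (-x)
  rw [add_neg_cancel, hs.map_zero, hs.map_neg] at h
  linarith

lemma convexOn (hs : IsNormOn sharp) : ConvexOn ℝ Set.univ sharp := by
  refine ⟨convex_univ, fun x _ y _ a b ha hb _ => ?_⟩
  have h := hs.triangle (a • x) (b • y)
  rwa [hs.smul_eq, hs.smul_eq, abs_of_nonneg ha, abs_of_nonneg hb] at h

lemma continuous [FiniteDimensional ℝ E] (hs : IsNormOn sharp) : Continuous sharp :=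
  continuousOn_univ.mp (hs.convexOn.continuousOn isOpen_univ)

/-- In finite dimension, the ambient norm is bounded by a multiple of any norm. -/
lemma exists_norm_le [FiniteDimensional ℝ E] (hs : IsNormOn sharp) :
    ∃ C : ℝ, 0 ≤ C ∧ ∀ v : E, ‖v‖ ≤ C * sharp v := by
  rcases (Metric.sphere (0 : E) 1).eq_empty_or_nonempty with h | h
  · refine ⟨0, le_rfl, fun v => ?_⟩
    by_contra! hv
    rw [zero_mul] at hv
    have hmem : ‖v‖⁻¹ • v ∈ Metric.sphere (0 : E) 1 := by
      simp [norm_smul, inv_mul_cancel₀ hv.ne']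
    simp [h] at hmem
  · obtain ⟨w, hw, hmin⟩ := (isCompact_sphere (0 : E) 1).exists_isMinOn h hs.continuous.continuousOn
    have hw0 : 0 < sharp w := by
      refine (hs.nonneg w).lt_of_ne' fun h0 => ?_
      simp [hs.eq_zero_of w h0] at hw
    refine ⟨(sharp w)⁻¹, inv_nonneg.mpr hw0.le, fun v => ?_⟩
    rcases eq_or_ne v 0 with rfl | hv
    · simp [hs.map_zero]
    have hv0 : 0 < ‖v‖ := norm_pos_iff.mpr hv
    have hmem : ‖v‖⁻¹ • v ∈ Metric.sphere (0 : E) 1 := by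
      simp [norm_smul, inv_mul_cancel₀ hv0.ne']
    have hle : sharp w ≤ sharp (‖v‖⁻¹ • v) := hmin hmem
    rw [hs.smul_eq, abs_of_pos (inv_pos.mpr hv0), inv_mul_eq_div, le_div_iff₀ hv0] at hle
    rwa [inv_mul_eq_div, le_div_iff₀ hw0, mul_comm]

lemma abs_inner_le_dualNorm_mul [FiniteDimensional ℝ E] (hs : IsNormOn sharp) (u v : E) :
    |⟪u, v⟫| ≤ dualNorm sharp u * sharp v := by
  obtain ⟨C, hC0, hC⟩ := hs.exists_norm_le
  have hbdd : BddAbove {r : ℝ | ∃ v : E, sharp v ≤ 1 ∧ r = |⟪u, v⟫|} := by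
    refine ⟨‖u‖ * C, ?_⟩
    rintro _ ⟨x, hx, rfl⟩
    refine (abs_real_inner_le_norm u x).trans ?_
    gcongr
    exact (hC x).trans (mul_le_of_le_one_right hC0 hx)
  rcases eq_or_ne v 0 with rfl | hv
  · simp [hs.map_zero]
  have hv0 : 0 < sharp v := (hs.nonneg v).lt_of_ne' fun h => hv (hs.eq_zero_of v h)
  have h : |⟪u, (sharp v)⁻¹ • v⟫| ≤ dualNorm sharp u := by
    refine le_csSup hbdd ⟨_, ?_, rfl⟩
    rw [hs.smul_eq, abs_of_pos (inv_pos.mpr hv0), inv_mul_cancel₀ hv0.ne']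
  rwa [real_inner_smul_right, abs_mul, abs_of_pos (inv_pos.mpr hv0), inv_mul_eq_div,
    div_le_iff₀ hv0] at h

end IsNormOn

/-- First-order optimality of a minimizer of a least squares objective with a convex penalty. -/
lemma inner_residual_le_of_isMin {F : Type*} [NormedAddCommGroup F] [InnerProductSpace ℝ F]
    {g : E → ℝ} (hg : ConvexOn ℝ Set.univ g) (Φ : E →ₗ[ℝ] F) (y : F) {x : E}
    (hmin : ∀ z : E, (1 / 2) * ‖Φ x - y‖ ^ 2 + g x ≤ (1 / 2) * ‖Φ z - y‖ ^ 2 + g z) (z : E) :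
    ⟪Φ x - y, Φ (x - z)⟫ ≤ g z - g x := by
  have key : ∀ t : ℝ, 0 < t → t ≤ 1 →
      ⟪Φ x - y, Φ (x - z)⟫ ≤ g z - g x + t * (‖Φ (x - z)‖ ^ 2 / 2) := by
    intro t ht ht1
    have hm := hmin ((1 - t) • x + t • z)
    have hc := hg.2 (Set.mem_univ x) (Set.mem_univ z) (sub_nonneg.mpr ht1) ht.le
      (sub_add_cancel 1 t)
    have hres : Φ ((1 - t) • x + t • z) - y = (Φ x - y) - t • Φ (x - z) := by
      simp only [map_add, map_smul, map_sub]
      module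
    rw [hres, norm_sub_sq_real (Φ x - y), real_inner_smul_right, norm_smul, mul_pow, Real.norm_eq_abs,
      sq_abs] at hm
    simp only [smul_eq_mul] at hc
    refine le_of_mul_le_mul_left ?_ ht
    linarith
  have hlim : Filter.Tendsto (fun t : ℝ => g z - g x + t * (‖Φ (x - z)‖ ^ 2 / 2))
      (nhdsWithin 0 (Set.Ioi 0)) (nhds (g z - g x)) := by
    have hcont : Continuous fun t : ℝ => g z - g x + t * (‖Φ (x - z)‖ ^ 2 / 2) := by fun_prop
    simpa using (hcont.tendsto 0).mono_left nhdsWithin_le_nhds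
  refine ge_of_tendsto hlim ?_
  filter_upwards [Ioc_mem_nhdsGT (zero_lt_one' ℝ)] with t ht
  exact key t ht.1 ht.2

/-- If adding `v` to `x` increases `sharp` by at most `κ * sharp v`, then `sharp v` is controlled by
the distance from `x` to `A` and by the ambient norm of `v`. -/
lemma IsCSSpace.sharp_le {sharp : E → ℝ} {A : Set E} {L κ : ℝ} (hcs : IsCSSpace A sharp L)
    (hs : IsNormOn sharp) {x v a : E} (ha : a ∈ A)
    (h : sharp (x + v) ≤ sharp x + κ * sharp v) :
    (1 - κ) * sharp v ≤ 2 * (sharp (x - a) + L * ‖v‖) := by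
  obtain ⟨z₁, z₂, rfl, hz₁, hz₂⟩ := hcs.decomp a ha v
  have h₁ := hs.triangle z₁ z₂
  have h₂ := hs.triangle (x - a) a
  have h₃ := hs.triangle (x + (z₁ + z₂)) (-(x - a) + -z₂)
  have h₄ := hs.triangle (-(x - a)) (-z₂)
  rw [show x + (z₁ + z₂) + (-(x - a) + -z₂) = a + z₁ by abel] at h₃
  rw [hs.map_neg, hs.map_neg] at h₄
  rw [sub_add_cancel] at h₂
  linarith

end

theorem lasso_of_robustWidth {M : ℕ} (sharp : H → ℝ) (hs : IsNormOn sharp)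
    (A : Set H) (L : ℝ) (hL : 0 < L) (hcs : IsCSSpace A sharp L)
    (Φ : H →ₗ[ℝ] EuclideanSpace ℝ (Fin M))
    (κ : ℝ) (hκ : κ ∈ Set.Ioo (0 : ℝ) 1)
    (ρ α : ℝ) (hα : 0 < α) (hρ : 0 < ρ) (hρL : ρ < (1 - κ) / (2 * L))
    (hrw : RobustWidth Φ sharp ρ α)
    (C₀ C₁ : ℝ) (hC₀ : C₀ = ((1 - κ) / (2 * ρ) - L)⁻¹) (hC₁ : C₁ = (1 + κ) / (α ^ 2 * ρ))
    (xnat : H) (lam : ℝ) (hlam : 0 < lam) (ω : EuclideanSpace ℝ (Fin M))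
    (hω : dualNorm sharp ((LinearMap.adjoint Φ) ω) ≤ κ * lam)
    (xstar : H)
    (hmin : ∀ x : H,
      (1 / 2) * ‖Φ xstar - (Φ xnat + ω)‖ ^ 2 + lam * sharp xstar ≤
        (1 / 2) * ‖Φ x - (Φ xnat + ω)‖ ^ 2 + lam * sharp x) :
    ∀ a ∈ A, ‖xstar - xnat‖ ≤ C₀ * sharp (xnat - a) + C₁ * lam := by
  intro a ha
  obtain ⟨hκ0, hκ1⟩ := hκ
  obtain ⟨v, rfl⟩ : ∃ v, xstar = xnat + v := ⟨xstar - xnat, by abel⟩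
  rw [add_sub_cancel_left]
  have hdual : ⟪ω, Φ v⟫ ≤ κ * lam * sharp v := by
    rw [← LinearMap.adjoint_inner_left]
    exact (le_abs_self _).trans ((hs.abs_inner_le_dualNorm_mul _ v).trans
      (mul_le_mul_of_nonneg_right hω (hs.nonneg v)))
  have hopt := inner_residual_le_of_isMin (g := fun x => lam * sharp x)
    (hs.convexOn.smul hlam.le) Φ (Φ xnat + ω) hmin xnat
  rw [add_sub_cancel_left, map_add, add_sub_add_left_eq_sub, inner_sub_left,
    real_inner_self_eq_norm_sq] at hopt
  have hcone : sharp (xnat + v) ≤ sharp xnat + κ * sharp v := by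
    refine le_of_mul_le_mul_left ?_ hlam
    linarith [sq_nonneg ‖Φ v‖]
  have hsharp := hcs.sharp_le hs ha hcone
  have hgap : 0 < (1 - κ) / (2 * ρ) - L := by
    rw [lt_div_iff₀ (by positivity)] at hρL
    rw [sub_pos, lt_div_iff₀ (by positivity)]
    linarith
  have hC₀_nonneg : 0 ≤ C₀ := hC₀ ▸ inv_nonneg.mpr hgap.le
  have hC₁_nonneg : 0 ≤ C₁ := by rw [hC₁]; positivity
  have hd := hs.nonneg (xnat - a)
  by_cases hv : ‖v‖ ≤ ρ * sharp v
  · have h : ‖v‖ ≤ C₀ * sharp (xnat - a) := by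
      rw [hC₀, inv_mul_eq_div, le_div_iff₀ hgap, mul_sub, mul_div_assoc', sub_le_iff_le_add,
        div_le_iff₀ (by positivity)]
      nlinarith [mul_le_mul_of_nonneg_left hv (sub_nonneg.mpr hκ1.le),
        mul_le_mul_of_nonneg_left hsharp hρ.le]
    exact h.trans (le_add_of_nonneg_right (by positivity))
  · have hΦ : α * ‖v‖ ≤ ‖Φ v‖ := le_of_not_gt fun h => hv (hrw v h)
    push Not at hv
    have hv0 : 0 < ‖v‖ := (mul_nonneg hρ.le (hs.nonneg v)).trans_lt hv
    have htri : sharp xnat ≤ sharp (xnat + v) + sharp v := by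
      simpa [hs.map_neg] using hs.triangle (xnat + v) (-v)
    have hsq : ‖Φ v‖ ^ 2 ≤ (1 + κ) * lam * sharp v := by
      linarith [mul_le_mul_of_nonneg_left htri hlam.le]
    have hsq' : (α * ‖v‖) ^ 2 ≤ (1 + κ) * lam * sharp v :=
      (pow_le_pow_left₀ (by positivity) hΦ 2).trans hsq
    have h : ‖v‖ ≤ C₁ * lam := by
      rw [hC₁, div_mul_eq_mul_div, le_div_iff₀ (by positivity)]
      refine le_of_mul_le_mul_right ?_ hv0
      have hc : 0 ≤ (1 + κ) * lam := by positivity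
      nlinarith [mul_le_mul_of_nonneg_left hsq' hρ.le, mul_le_mul_of_nonneg_left hv.le hc]
    exact h.trans (le_add_of_nonneg_left (by positivity))
end
end

section
/- Let (H, A, ‖·‖♯) be a compressed sensing space with bound L, let Φ : H → ℝ^M be a nonzero linear map, set τ = sup{‖Φx‖₂ : ‖x‖♯ ≤ 1}, and fix κ ∈ (0,1) and constants C₀, C₁ > 0. Suppose that for every x♮ ∈ H, every λ > 0, and every ω ∈ ℝ^M with ‖Φᵀω‖♦ ≤ κλ, any minimizer x* of x ↦ (1/2)‖Φx − (Φx♮ + ω)‖₂² + λ‖x‖♯ satisfies ‖x* − x♮‖₂ ≤ C₀‖x♮ − a‖♯ + C₁·λ for every a ∈ A. Then Φ satisfies the (ρ,α)-robust width property over the unit ♯-ball with ρ = 2C₀ and α = κ/(2τC₁). -/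
noncomputable section

open scoped RealInnerProductSpace

variable {H : Type*} [NormedAddCommGroup H] [InnerProductSpace ℝ H] [FiniteDimensional ℝ H]

theorem nonneg_of_triangle_of_smul {E : Type*} [AddCommGroup E] [Module ℝ E] {N : E → ℝ}
    (triangle : ∀ x y, N (x + y) ≤ N x + N y) (smul_eq : ∀ (c : ℝ) x, N (c • x) = |c| * N x)
    (x : E) : 0 ≤ N x := by
  have zero : N 0 = 0 := by simpa using smul_eq 0 0
  have h := triangle x ((-1 : ℝ) • x)
  rw [smul_eq, neg_one_smul, add_neg_cancel, zero] at h
  norm_num at h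
  linarith

/-- A linear map is bounded on the unit ball of any norm on a finite-dimensional real space. -/
theorem exists_norm_map_le_mul_of_norm {E F : Type*} [AddCommGroup E] [Module ℝ E]
    [FiniteDimensional ℝ E] [NormedAddCommGroup F] [NormedSpace ℝ F] (f : E →ₗ[ℝ] F) (N : E → ℝ)
    (triangle : ∀ x y, N (x + y) ≤ N x + N y) (smul_eq : ∀ (c : ℝ) x, N (c • x) = |c| * N x)
    (eq_zero_of : ∀ x, N x = 0 → x = 0) : ∃ C, 0 ≤ C ∧ ∀ x, ‖f x‖ ≤ C * N x := by
  have zero : N 0 = 0 := by simpa using smul_eq 0 0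
  have nonneg := nonneg_of_triangle_of_smul triangle smul_eq
  let : Norm E := ⟨N⟩
  have core : NormedSpace.Core ℝ E :=
    { norm_nonneg := nonneg
      norm_smul := smul_eq
      norm_triangle := triangle
      norm_eq_zero_iff := fun x => ⟨eq_zero_of x, fun h => h ▸ zero⟩ }
  let : NormedAddCommGroup E := NormedAddCommGroup.ofCore core
  let : NormedSpace ℝ E := NormedSpace.ofCore core
  exact ⟨‖f.toContinuousLinearMap‖, norm_nonneg _, f.toContinuousLinearMap.le_opNorm⟩

theorem IsNormOn.norm_map_le_sSup {M : ℕ} {sharp : H → ℝ} (hs : IsNormOn sharp)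
    (Φ : H →ₗ[ℝ] EuclideanSpace ℝ (Fin M)) {v : H} (hv : sharp v ≤ 1) :
    ‖Φ v‖ ≤ sSup {r : ℝ | ∃ x : H, sharp x ≤ 1 ∧ r = ‖Φ x‖} := by
  obtain ⟨C, hC, hbound⟩ :=
    exists_norm_map_le_mul_of_norm Φ sharp hs.triangle hs.smul_eq hs.eq_zero_of
  refine le_csSup ⟨C, ?_⟩ ⟨v, hv, rfl⟩
  rintro _ ⟨x, hx, rfl⟩
  exact (hbound x).trans (mul_le_of_le_one_right hC hx)

theorem dualNorm_adjoint_le {M : ℕ} {sharp : H → ℝ}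
    (Φ : H →ₗ[ℝ] EuclideanSpace ℝ (Fin M)) {τ : ℝ} (hτ : 0 ≤ τ)
    (hΦ : ∀ v, sharp v ≤ 1 → ‖Φ v‖ ≤ τ) (ω : EuclideanSpace ℝ (Fin M)) :
    dualNorm sharp (LinearMap.adjoint Φ ω) ≤ τ * ‖ω‖ := by
  refine Real.sSup_le ?_ (by positivity)
  rintro _ ⟨v, hv, rfl⟩
  rw [LinearMap.adjoint_inner_left, mul_comm]
  exact (abs_real_inner_le_norm _ _).trans (by gcongr; exact hΦ v hv)

theorem robustWidth_of_lasso {M : ℕ} (sharp : H → ℝ) (hs : IsNormOn sharp)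
    (A : Set H) (L : ℝ) (hcs : IsCSSpace A sharp L)
    (Φ : H →ₗ[ℝ] EuclideanSpace ℝ (Fin M)) (hΦ : Φ ≠ 0)
    (τ : ℝ) (hτ : τ = sSup {r : ℝ | ∃ x : H, sharp x ≤ 1 ∧ r = ‖Φ x‖})
    (κ : ℝ) (hκ : κ ∈ Set.Ioo (0 : ℝ) 1)
    (C₀ C₁ : ℝ) (hC₀ : 0 < C₀) (hC₁ : 0 < C₁)
    (hb : ∀ xnat : H, ∀ lam : ℝ, 0 < lam → ∀ ω : EuclideanSpace ℝ (Fin M),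
      dualNorm sharp ((LinearMap.adjoint Φ) ω) ≤ κ * lam →
      ∀ xstar : H,
        (∀ x : H,
          (1 / 2) * ‖Φ xstar - (Φ xnat + ω)‖ ^ 2 + lam * sharp xstar ≤
            (1 / 2) * ‖Φ x - (Φ xnat + ω)‖ ^ 2 + lam * sharp x) →
        ∀ a ∈ A, ‖xstar - xnat‖ ≤ C₀ * sharp (xnat - a) + C₁ * lam) :
    RobustWidth Φ sharp (2 * C₀) (κ / (2 * τ * C₁)) := by
  intro x hx
  have zero : sharp 0 = 0 := by simpa using hs.smul_eq 0 0
  rcases eq_or_ne x 0 with rfl | hx0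
  · simp [zero]
  have hxpos : 0 < ‖x‖ := norm_pos_iff.mpr hx0
  have hle (v : H) (hv : sharp v ≤ 1) : ‖Φ v‖ ≤ τ := hτ ▸ hs.norm_map_le_sSup Φ hv
  have hτ0 : 0 ≤ τ := (norm_nonneg _).trans (hle 0 (by simp [zero]))
  have hlam : 0 < ‖x‖ / (2 * C₁) := by positivity
  have hτx : τ * ‖Φ x‖ ≤ κ * (‖x‖ / (2 * C₁)) := by
    rcases hτ0.eq_or_lt with h | h
    · rw [← h, zero_mul]
      exact mul_nonneg hκ.1.le hlam.le
    · calc τ * ‖Φ x‖ ≤ τ * (κ / (2 * τ * C₁) * ‖x‖) := by gcongr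
        _ = κ * (‖x‖ / (2 * C₁)) := by field_simp
  have hdual : dualNorm sharp (LinearMap.adjoint Φ (-Φ x)) ≤ κ * (‖x‖ / (2 * C₁)) :=
    (dualNorm_adjoint_le Φ hτ0 hle _).trans (by rwa [norm_neg])
  have hmin := hb x _ hlam (-Φ x) hdual 0 (fun y => by
    have := mul_nonneg hlam.le (nonneg_of_triangle_of_smul hs.triangle hs.smul_eq y)
    simp only [map_zero, add_neg_cancel, sub_zero, norm_zero, zero]
    nlinarith [sq_nonneg ‖Φ y‖]) 0 hcs.zero_mem
  have hhalf : C₁ * (‖x‖ / (2 * C₁)) = ‖x‖ / 2 := by field_simp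
  rw [zero_sub, norm_neg, sub_zero, hhalf] at hmin
  linarith
end
end

section
/- Let (H, A, ‖·‖♯) be a compressed sensing space with bound L and let x♮, x* ∈ H satisfy ‖x*‖♯ ≤ ‖x♮‖♯. Then with z = x* − x♮, for every a ∈ A, ‖z‖♯ ≤ 2‖x♮ − a‖♯ + 2L‖z‖₂. -/
noncomputable section

open scoped RealInnerProductSpace

variable {H : Type*} [NormedAddCommGroup H] [InnerProductSpace ℝ H] [FiniteDimensional ℝ H]

theorem sharp_sub_le_of_cs (sharp : H → ℝ) (hs : IsNormOn sharp)
    (A : Set H) (L : ℝ) (hcs : IsCSSpace A sharp L)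
    (xnat xstar : H) (hle : sharp xstar ≤ sharp xnat)
    (z : H) (hz : z = xstar - xnat) :
    ∀ a ∈ A, sharp z ≤ 2 * sharp (xnat - a) + 2 * L * ‖z‖ := by
  intro a ha
  obtain ⟨z₁, z₂, hdecomp, hadd, hz₂⟩ := hcs.decomp a ha z
  have hneg : ∀ x : H, sharp (-x) = sharp x := fun x => by
    simpa using hs.smul_eq (-1) x
  have hsplit : a + z₁ = (xstar + -(xnat - a)) + -z₂ := by
    rw [show z₁ = z - z₂ by rw [hdecomp]; abel, hz]
    abel
  have h₁ : sharp (a + z₁) ≤ sharp (xstar + -(xnat - a)) + sharp z₂ := by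
    rw [hsplit, ← hneg z₂]
    exact hs.triangle _ _
  have h₂ : sharp (xstar + -(xnat - a)) ≤ sharp xstar + sharp (xnat - a) := by
    rw [← hneg (xnat - a)]
    exact hs.triangle _ _
  have h₃ : sharp xnat ≤ sharp (xnat - a) + sharp a := by
    simpa using hs.triangle (xnat - a) a
  have h₄ : sharp z ≤ sharp z₁ + sharp z₂ :=
    (congrArg sharp hdecomp).trans_le (hs.triangle z₁ z₂)
  linarith
end
end
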